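/- For d ∈ {1, 2, 3, 7} and K = ℚ(√−d), there is no Galois extension L/K of degree 3 which is unramified at every prime ideal of O_K not dividing 2. -/

import Mathlib

open NumberField

section helpers

open Pointwise

lemma eq_of_le_of_absNorm {R : Type*} [CommRing R] [IsDedekindDomain R] [Module.Free ℤ R] [Module.Finite ℤ R]
    [CharZero R] {I J : Ideal R} (h : I ≤ J) (hI : I ≠ ⊥) (hn : Ideal.absNorm I = Ideal.absNorm J) : I = J := by
  obtain ⟨C, rfl⟩ := Ideal.dvd_iff_le.mpr h
  rw [map_mul] at hn
  have h0 : Ideal.absNorm J ≠ 0 := by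
    rw [Ne, Ideal.absNorm_eq_zero_iff]; rintro rfl; simp at hI
  have : Ideal.absNorm C = 1 := by
    have := Nat.eq_of_mul_eq_mul_left (Nat.pos_of_ne_zero h0) (hn.trans (mul_one _).symm)
    exact this
  rw [Ideal.absNorm_eq_one_iff] at this
  simp [this]

variable (K : Type) [Field K] [NumberField K] (L : Type) [Field L] [Algebra K L] [NumberField L] [IsGalois K L]


lemma lemA (hdeg : Module.finrank K L = 3) (p : Ideal (𝓞 K)) (P : Ideal (𝓞 L)) [p.IsPrime] [P.IsPrime]
    [P.LiesOver p] (hp : p ≠ ⊥) (he : Ideal.ramificationIdx' p P ≠ 1) :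
    p.map (algebraMap (𝓞 K) (𝓞 L)) = P ^ 3 ∧ Ideal.absNorm P = Ideal.absNorm p ∧
      ∀ σ : Gal(L/K), σ • P = P := by
  have hG : Nat.card Gal(L/K) = 3 := by rw [IsGalois.card_aut_eq_finrank, hdeg]
  have h := Ideal.ncard_primesOver_mul_ramificationIdxIn_mul_inertiaDegIn p (𝓞 L) Gal(L/K)
  rw [hG, Ideal.ramificationIdxIn_eq_ramificationIdx p P Gal(L/K), Ideal.inertiaDegIn_eq_inertiaDeg p P Gal(L/K)] at h
  rw [Ideal.ramificationIdx'_eq_ramificationIdx p P hp] at he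
  have he3 : P.ramificationIdx (𝓞 K) = 3 := by
    have : P.ramificationIdx (𝓞 K) ∣ 3 := ⟨_, (by rw [← h]; ring :  3 = P.ramificationIdx (𝓞 K) * ((p.primesOver (𝓞 L)).ncard * P.inertiaDeg (𝓞 K)))⟩
    exact ((Nat.dvd_prime Nat.prime_three).mp this).resolve_left he
  rw [he3] at h
  have h1 : (p.primesOver (𝓞 L)).ncard * P.inertiaDeg (𝓞 K) = 1 := by linarith
  obtain ⟨hn, hf⟩ := _root_.mul_eq_one.mp h1
  have hN : Ideal.absNorm P = Ideal.absNorm p := by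
    have := Ideal.absNorm_pow_inertiaDeg p P
    rw [hf, pow_one] at this; exact this.symm
  have hmap : p.map (algebraMap (𝓞 K) (𝓞 L)) ≠ ⊥ := Ideal.map_ne_bot_of_ne_bot hp
  refine ⟨?_, hN, ?_⟩
  · apply eq_of_le_of_absNorm _ hmap
    · rw [Ideal.absNorm_algebraMap, map_pow, hN,← IsFractionRing.finrank_eq (𝓞 K) K (𝓞 L) L, hdeg]
    · apply Ideal.le_pow_of_le_ramificationIdx'
      rw [Ideal.ramificationIdx'_eq_ramificationIdx p P hp, he3]
  · intro σ
    obtain ⟨Q, hQ⟩ := Set.ncard_eq_one.mp hn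
    have h1 : P ∈ p.primesOver (𝓞 L) := ⟨inferInstance, inferInstance⟩
    have h2 : σ • P ∈ p.primesOver (𝓞 L) := ⟨inferInstance, inferInstance⟩
    rw [hQ] at h1 h2
    exact (Set.mem_singleton_iff.mp h2).trans (Set.mem_singleton_iff.mp h1).symm

lemma lemB (hdeg : Module.finrank K L = 3) (p : Ideal (𝓞 K)) (P : Ideal (𝓞 L)) [p.IsPrime] [P.IsPrime]
    [P.LiesOver p] (hp : p ≠ ⊥) (hN : Ideal.absNorm p = 2) : Ideal.ramificationIdx' p P = 1 := by
  by_contra he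
  obtain ⟨h3, hNP, hσ⟩ := lemA K L hdeg p P hp he
  have hP : P ≠ ⊥ := Ideal.ne_bot_of_liesOver_of_ne_bot hp P
  have hlt : P ^ 2 < P := by 
    simpa using Ideal.pow_succ_lt_pow hP 1
  obtain ⟨π, hπ, hπ2⟩ := SetLike.exists_of_lt hlt
  have h2P : (2 : 𝓞 L) ∈ P := by
    have := Ideal.absNorm_mem P
    rw [hNP, hN] at this; exact_mod_cast this
  have hcard (d : 𝓞 L) (hd : d ∉ P) : d - 1 ∈ P := by
    have hc : Nat.card (𝓞 L ⧸ P) = 2 := by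
      rw [← hN, ← hNP]; rfl
    rw [← Ideal.Quotient.eq_zero_iff_mem] at hd ⊢
    have h1 : (1 : 𝓞 L ⧸ P) ≠ 0 := by
      rw [← map_one (Ideal.Quotient.mk P), Ne, Ideal.Quotient.eq_zero_iff_mem]
      exact fun h => Ideal.IsPrime.ne_top ‹_› ((Ideal.eq_top_iff_one _).mpr h)
    rw [map_sub, map_one, sub_eq_zero]
    obtain ⟨x, y, hxy, hu⟩ := Nat.card_eq_two_iff.mp hc
    have := hu.ge (Set.mem_univ (Ideal.Quotient.mk P d))
    have := hu.ge (Set.mem_univ 1)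
    have := hu.ge (Set.mem_univ 0)
    simp only [Set.mem_insert_iff, Set.mem_singleton_iff] at *
    grind
  have key (σ : Gal(L/K)) : σ • π - π ∈ P ^ 2 := by
    have hm : σ • π ∈ P := by
      rw [← hσ σ]; exact Ideal.smul_mem_pointwise_smul _ _ _ hπ
    have hm2 : σ • π ∉ P ^ 2 := by
      intro h
      have hs : σ • (P ^ 2) = P ^ 2 := by
        rw [smul_pow', hσ]
      rw [← hs, Ideal.smul_mem_pointwise_smul_iff] at h
      exact hπ2 h
    obtain ⟨d, e, hee, h⟩ := Ideal.exists_mul_add_mem_pow_succ (i := 1) hP π (σ • π) (by simpa) hπ2 (by simpa)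
    have hd : d ∉ P := by
      intro hd
      apply hm2
      rw [← h]
      refine add_mem ?_ hee
      rw [pow_two]; exact Ideal.mul_mem_mul hπ hd
    have : σ • π - π = π * (d - 1) + e := by rw [← h]; ring
    rw [this]
    refine add_mem ?_ hee
    rw [pow_two]; exact Ideal.mul_mem_mul hπ (hcard d hd)
  have hG : Nat.card Gal(L/K) = 3 := by rw [IsGalois.card_aut_eq_finrank, hdeg]
  obtain ⟨t, ht⟩ := Algebra.IsInvariant.isInvariant (A := 𝓞 K) (G := Gal(L/K)) (∑ σ : Gal(L/K), σ • π) (by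
    intro g
    rw [Finset.smul_sum]
    simp_rw [smul_smul]
    exact Fintype.sum_equiv (Equiv.mulLeft g) _ _ (fun _ => rfl))
  have hsum : ∑ σ : Gal(L/K), σ • π = ∑ σ : Gal(L/K), (σ • π - π) + 3 * π := by
    rw [Finset.sum_sub_distrib]
    simp [← Nat.card_eq_fintype_card, hG]
  have hmem : ∑ σ : Gal(L/K), (σ • π - π) ∈ P ^ 2 := Ideal.sum_mem _ fun σ _ => key σ
  have htP : algebraMap (𝓞 K) (𝓞 L) t ∈ P := by
    rw [ht, hsum]
    exact add_mem (Ideal.pow_le_self two_ne_zero hmem) (Ideal.mul_mem_left _ _ hπ)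
  have htp : t ∈ p := by
    rw [Ideal.over_def P p]; exact htP
  have htm : algebraMap (𝓞 K) (𝓞 L) t ∈ P ^ 2 := by
    have := Ideal.mem_map_of_mem (algebraMap (𝓞 K) (𝓞 L)) htp
    rw [h3] at this
    exact Ideal.pow_le_pow_right (by norm_num) this
  apply hπ2
  have : π = algebraMap (𝓞 K) (𝓞 L) t - ∑ σ : Gal(L/K), (σ • π - π) - 2 * π := by
    rw [ht, hsum]; ring
  rw [this]
  refine sub_mem (sub_mem htm hmem) ?_
  rw [pow_two]; exact Ideal.mul_mem_mul h2P hπ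

lemma lemC0 (p : Ideal (𝓞 K)) (P : Ideal (𝓞 L)) [p.IsPrime] [P.IsPrime]
    [P.LiesOver p] (hp : p ≠ ⊥) (h : P ∣ differentIdeal (𝓞 K) (𝓞 L)) :
    Ideal.ramificationIdx' p P ≠ 1 := by
  intro he
  rw [Ideal.ramificationIdx'_eq_ramificationIdx p P hp, Ideal.ramificationIdx_eq_one_iff] at he
  exact not_dvd_differentIdeal_iff.mpr he h

lemma lemC1 (hK : Module.finrank ℚ K = 2) (hdeg : Module.finrank K L = 3)
    (hunr : ∀ P : Ideal (𝓞 K), P.IsPrime → P ≠ ⊥ → (2 : 𝓞 K) ∉ P →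
      ∀ Q : Ideal (𝓞 L), Q.IsPrime → Q.comap (algebraMap (𝓞 K) (𝓞 L)) = P →
        Ideal.ramificationIdx' P Q = 1) (P : Ideal (𝓞 L)) [P.IsPrime] (hP : P ≠ ⊥)
    (h : P ∣ differentIdeal (𝓞 K) (𝓞 L)) :
    Prime (2 : 𝓞 K) ∧ (Ideal.span {(2 : 𝓞 K)}).map (algebraMap (𝓞 K) (𝓞 L)) = P ^ 3 ∧
      Ideal.absNorm P = 4 := by
  set p : Ideal (𝓞 K) := P.under (𝓞 K) with hpdef
  have hp : p ≠ ⊥ := mt Ideal.eq_bot_of_comap_eq_bot hP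
  have he := lemC0 K L p P hp h
  have h2 : (2 : 𝓞 K) ∈ p := by
    by_contra h2
    exact he (hunr p inferInstance hp h2 P inferInstance rfl)
  have hN2 : Ideal.absNorm (Ideal.span {(2 : 𝓞 K)}) = 4 := by
    rw [Ideal.absNorm_span_singleton]
    have := Algebra.norm_algebraMap (R := ℤ) (S := 𝓞 K) 2
    rw [RingOfIntegers.rank, hK] at this
    have h' : algebraMap ℤ (𝓞 K) 2 = 2 := by simp
    rw [h'] at this
    rw [this]; rfl
  have hle : Ideal.span {(2 : 𝓞 K)} ≤ p := by
    rwa [Ideal.span_singleton_le_iff_mem]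
  have hdvd := Ideal.absNorm_dvd_absNorm_of_le hle
  rw [hN2] at hdvd
  have hn1 : Ideal.absNorm p ≠ 1 := by
    rw [Ne, Ideal.absNorm_eq_one_iff]
    exact Ideal.IsPrime.ne_top inferInstance
  have hn2 : Ideal.absNorm p ≠ 2 := fun hn => he (lemB K L hdeg p P hp hn)
  have h4 : Ideal.absNorm p = 4 := by
    have := Nat.le_of_dvd (by norm_num) hdvd
    interval_cases (Ideal.absNorm p) <;> omega
  have hsp : Ideal.span {(2 : 𝓞 K)} = p := by
    apply eq_of_le_of_absNorm hle
    · simp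
    · rw [hN2, h4]
  obtain ⟨h3, hN, -⟩ := lemA K L hdeg p P hp he
  refine ⟨?_, by rw [hsp, h3], by rw [hN, h4]⟩
  rw [← Ideal.span_singleton_prime two_ne_zero, hsp]
  infer_instance

lemma lemC (hK : Module.finrank ℚ K = 2) (hdeg : Module.finrank K L = 3)
    (hunr : ∀ P : Ideal (𝓞 K), P.IsPrime → P ≠ ⊥ → (2 : 𝓞 K) ∉ P →
      ∀ Q : Ideal (𝓞 L), Q.IsPrime → Q.comap (algebraMap (𝓞 K) (𝓞 L)) = P →
        Ideal.ramificationIdx' P Q = 1) :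
    Ideal.absNorm (differentIdeal (𝓞 K) (𝓞 L)) = 1 ∨
    (Prime (2 : 𝓞 K) ∧ Ideal.absNorm (differentIdeal (𝓞 K) (𝓞 L)) ≤ 16) := by
  by_cases hD : differentIdeal (𝓞 K) (𝓞 L) = ⊤
  · left; simp [hD]
  right
  have hD0 : differentIdeal (𝓞 K) (𝓞 L) ≠ ⊥ := differentIdeal_ne_bot
  obtain ⟨P, hPm, hPle⟩ := Ideal.exists_le_maximal _ hD
  have hP0 : P ≠ ⊥ := by rintro rfl; exact hD0 (le_bot_iff.mp hPle)
  obtain ⟨hprime, hP3, hPN⟩ := lemC1 K L hK hdeg hunr P hP0 (Ideal.dvd_iff_le.mpr hPle)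
  refine ⟨hprime, ?_⟩
  have hrep := Multiset.eq_replicate_of_mem (a := P)
    (s := UniqueFactorizationMonoid.normalizedFactors (differentIdeal (𝓞 K) (𝓞 L))) (by
      intro Q hQ
      have hQp := UniqueFactorizationMonoid.prime_of_normalized_factor Q hQ
      have := Ideal.isPrime_of_prime hQp
      obtain ⟨-, hQ3, -⟩ := lemC1 K L hK hdeg hunr Q hQp.ne_zero
        (UniqueFactorizationMonoid.dvd_of_mem_normalizedFactors hQ)
      rw [hP3] at hQ3
      have : Q ∣ P := hQp.dvd_of_dvd_pow (hQ3 ▸ dvd_pow_self Q three_ne_zero)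
      have hPQ := Ideal.dvd_iff_le.mp this
      exact (hPm.eq_of_le (Ideal.IsPrime.ne_top ‹_›) hPQ).symm)
  set k := (UniqueFactorizationMonoid.normalizedFactors (differentIdeal (𝓞 K) (𝓞 L))).card
  have hDk : differentIdeal (𝓞 K) (𝓞 L) = P ^ k := by
    rw [← Ideal.prod_normalizedFactors_eq_self hD0, hrep, Multiset.prod_replicate]
  have h3 : ¬ P ^ 3 ∣ differentIdeal (𝓞 K) (𝓞 L) := by
    apply not_dvd_differentIdeal_of_intTrace_not_mem (𝓞 K) (p := Ideal.span {2}) (P ^ 3) ⊤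
      (by rw [hP3]; simp) 1 (by simp)
    have h1 : Algebra.intTrace (𝓞 K) (𝓞 L) 1 = 3 := by
      apply FaithfulSMul.algebraMap_injective (𝓞 K) K
      rw [Algebra.algebraMap_intTrace (L := L), map_one, ← map_one (algebraMap K L), Algebra.trace_algebraMap, hdeg]
      simp [map_ofNat]
    rw [h1]
    intro h
    apply hprime.not_isUnit
    rw [← Ideal.span_singleton_eq_top, Ideal.eq_top_iff_one]
    have : (1 : 𝓞 K) = 3 - 2 := by norm_num
    rw [this]
    exact sub_mem h (Ideal.mem_span_singleton_self _)
  have hk : k < 3 := by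
    by_contra hk
    apply h3
    rw [hDk]
    exact pow_dvd_pow _ (by omega)
  rw [hDk, map_pow, hPN]
  calc 4 ^ k ≤ 4 ^ 2 := Nat.pow_le_pow_right (by norm_num) (by omega)
    _ = 16 := by norm_num

lemma lemMink (d : ℕ) (hd : 0 < d) (s : K) (hs : s ^ 2 = -(d : K)) (hK : Module.finrank ℚ K = 2)
    (hdeg : Module.finrank K L = 3) : 512 < (discr L).natAbs := by
  have h6 : Module.finrank ℚ L = 6 := by
    rw [← Module.finrank_mul_finrank ℚ K L, hK, hdeg]
  have : IsTotallyComplex L := by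
    refine ⟨fun v => ?_⟩
    rw [← InfinitePlace.not_isReal_iff_isComplex]
    intro hv
    have h1 := hv
    rw [InfinitePlace.isReal_iff] at h1
    have h2 := congrArg (fun x => h1.embedding (algebraMap K L x)) hs
    simp at h2
    have h3 : (0:ℝ) < d := by exact_mod_cast hd
    nlinarith [sq_nonneg (h1.embedding (algebraMap K L s))]
  have h := abs_discr_ge_of_isTotallyComplex L
  rw [h6] at h
  have hpi : (4 / Real.pi) ^ 6 ≤ (4 / 3) ^ 6 := by
    gcongr
    exact Real.pi_gt_three.le
  have h512 : (512 : ℝ) < |discr L| := by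
    refine lt_of_lt_of_le ?_ h
    rw [lt_div_iff₀ (by positivity)]
    norm_num [Nat.factorial] at hpi ⊢
    have : (0:ℝ) < (4 / Real.pi) ^ 6 := by positivity
    nlinarith
  rw [Int.abs_eq_natAbs] at h512
  exact_mod_cast h512

end helpers

lemma lemD {K : Type} [Field K] [NumberField K] (hK : Module.finrank ℚ K = 2) (x : 𝓞 K) (b c : ℤ)
    (hx : x ^ 2 + b * x + c = 0)
    (hneg : b ^ 2 - 4 * c < 0) : (discr K).natAbs ∣ (b ^ 2 - 4 * c).natAbs := by
  have hxK : (x : K) ^ 2 + b * (x : K) + c = 0 := by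
    have := congrArg (algebraMap (𝓞 K) K) hx
    simpa using this
  have hadj : Algebra.adjoin ℚ {algebraMap (𝓞 K) K x} = ⊤ := by
    have := Subalgebra.isSimpleOrder_of_finrank_prime ℚ K (by rw [hK]; exact Nat.prime_two)
    refine (eq_bot_or_eq_top _).resolve_left fun hbot => ?_
    have hm : algebraMap (𝓞 K) K x ∈ (⊥ : Subalgebra ℚ K) := by
      rw [← hbot]; exact Algebra.self_mem_adjoin_singleton ℚ _
    obtain ⟨q, hq⟩ := Algebra.mem_bot.mp hm
    have hq' : (algebraMap ℚ K) q = (x : K) := hq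
    rw [← hq'] at hxK
    have h0 : q ^ 2 + b * q + c = 0 := by
      apply FaithfulSMul.algebraMap_injective ℚ K
      simpa using hxK
    have hneg' : ((b ^ 2 - 4 * c : ℤ) : ℚ) < 0 := by exact_mod_cast hneg
    push_cast at hneg'
    nlinarith [sq_nonneg (2 * q + b)]
  have hintg : IsIntegral ℤ x := Algebra.IsIntegral.isIntegral x
  open Polynomial in
  have hmin : minpoly ℤ x = X ^ 2 + C b * X + C c := by
    have hmon : (X ^ 2 + C b * X + C c : ℤ[X]).Monic := by monicity!
    have hdegf : (X ^ 2 + C b * X + C c : ℤ[X]).natDegree = 2 := by compute_degree!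
    have hdvd : minpoly ℤ x ∣ X ^ 2 + C b * X + C c :=
      minpoly.isIntegrallyClosed_dvd hintg (by simpa using hx)
    have hle := natDegree_le_of_dvd hdvd hmon.ne_zero
    have hpos := minpoly.natDegree_pos hintg
    have hne : (minpoly ℤ x).natDegree ≠ 1 := by
      rw [Ne, minpoly.natDegree_eq_one_iff]
      rintro ⟨n, rfl⟩
      have h0 : n ^ 2 + b * n + c = 0 := by
        apply FaithfulSMul.algebraMap_injective ℤ (𝓞 K)
        simpa using hx
      nlinarith [sq_nonneg (2 * n + b)]
    exact (eq_of_monic_of_dvd_of_natDegree_le (minpoly.monic hintg) hmon hdvd (by omega)).symm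
  have hmem := aeval_derivative_mem_differentIdeal ℤ ℚ K x hadj
  rw [hmin] at hmem
  have h2 : (Polynomial.aeval x) (2 : Polynomial ℤ) = 2 := map_ofNat _ 2
  simp [h2] at hmem
  have hd := Ideal.absNorm_dvd_absNorm_of_le ((Ideal.span_singleton_le_iff_mem _).mpr hmem)
  rw [absNorm_differentIdeal K (𝓞 K)] at hd
  have hsq : (2 * x + b) ^ 2 = algebraMap ℤ (𝓞 K) (b ^ 2 - 4 * c) := by
    simp only [algebraMap_int_eq, eq_intCast, Int.cast_sub, Int.cast_pow, Int.cast_mul, Int.cast_ofNat]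
    linear_combination 4 * hx
  have hn : (Ideal.absNorm (Ideal.span {2 * x + (b : 𝓞 K)})) ^ 2 = (b ^ 2 - 4 * c).natAbs ^ 2 := by
    rw [← map_pow, Ideal.span_singleton_pow, hsq, Ideal.absNorm_span_singleton,
      Algebra.norm_algebraMap, RingOfIntegers.rank, hK, Int.natAbs_pow]
  rw [Nat.pow_left_injective two_ne_zero hn] at hd
  exact hd

lemma two_not_prime_of_sq_eq_neg_one {R : Type*} [CommRing R] [IsDomain R] (x : R) (hx : x ^ 2 = -1) : ¬ Prime (2 : R) := by
  intro h
  have h1 : (2 : R) ∣ (1 + x) ^ 2 := ⟨x, by linear_combination hx⟩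
  obtain ⟨t, ht⟩ := h.dvd_of_dvd_pow h1
  have h2 : 2 * t ^ 2 - x = 0 :=
    mul_left_cancel₀ h.ne_zero (by linear_combination -(1 + x + 2 * t) * ht + hx)
  exact h.not_isUnit (IsUnit.of_mul_eq_one (-(t ^ 2 * x)) (by linear_combination -x * h2 - hx))

lemma not_prime_seven {K : Type} [Field K] [NumberField K] (x : 𝓞 K)
    (hx : x ^ 2 - x + 2 = 0) : ¬ Prime (2 : 𝓞 K) := by
  intro h
  have h1 : (2 : 𝓞 K) ∣ x * (1 - x) := ⟨1, by linear_combination -hx⟩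
  obtain ⟨t, ht⟩ : ∃ t : 𝓞 K, 2 * t ^ 2 - t + 1 = 0 := by
    rcases h.dvd_or_dvd h1 with ⟨t, ht⟩ | ⟨t, ht⟩
    · refine ⟨t, mul_left_cancel₀ (two_ne_zero (α := 𝓞 K)) ?_⟩
      linear_combination hx + (1 - x - 2 * t) * ht
    · refine ⟨t, mul_left_cancel₀ (two_ne_zero (α := 𝓞 K)) ?_⟩
      linear_combination hx + (x - 2 * t) * ht
  have hintg : IsIntegral ℤ t := Algebra.IsIntegral.isIntegral t
  open Polynomial in
  have hdvd : minpoly ℤ t ∣ (2 * X ^ 2 - X + 1 : ℤ[X]) :=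
    by
    have h2 : (aeval t) (2 : ℤ[X]) = 2 := map_ofNat _ 2
    exact minpoly.isIntegrallyClosed_dvd hintg (by simpa [h2] using ht)
  obtain ⟨q, hq⟩ := hdvd
  have hmon := minpoly.monic hintg
  have hpos := minpoly.natDegree_pos hintg
  have hle : (minpoly ℤ t).natDegree ≤ 1 := by
    have h2 := congrArg (Polynomial.map (Int.castRingHom (ZMod 2))) hq
    have h20 : (2 : Polynomial (ZMod 2)) = 0 := CharTwo.two_eq_zero
    simp [h20] at h2
    rw [← hmon.natDegree_map (Int.castRingHom (ZMod 2))]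
    have hne : (-Polynomial.X + 1 : Polynomial (ZMod 2)).natDegree = 1 := by compute_degree!
    rw [← hne]
    apply Polynomial.natDegree_le_of_dvd ⟨_, h2⟩
    intro h0
    rw [h0] at hne
    simp at hne
  obtain ⟨n, rfl⟩ := minpoly.natDegree_eq_one_iff.mp (le_antisymm hle hpos)
  have h0 : 2 * n ^ 2 - n + 1 = 0 := by
    apply FaithfulSMul.algebraMap_injective ℤ (𝓞 K)
    simpa using ht
  nlinarith [sq_nonneg (n - 1), sq_nonneg n]

/-- For `d ∈ {1, 2, 3, 7}` and `K = ℚ(√-d)`, there is no Galois extension `L/K` of degree `3`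
which is unramified at every prime ideal of `O_K` not dividing `2`. -/
theorem no_cubic_extension_unramified_outside_two
    (d : ℕ) (hd : d ∈ ({1, 2, 3, 7} : Finset ℕ))
    (K : Type) [Field K] [NumberField K]
    (s : K) (hs : s ^ 2 = -(d : K)) (hK : Module.finrank ℚ K = 2)
    (L : Type) [Field L] [Algebra K L] [NumberField L] [IsGalois K L]
    (hdeg : Module.finrank K L = 3)
    (hunr : ∀ P : Ideal (𝓞 K), P.IsPrime → P ≠ ⊥ → (2 : 𝓞 K) ∉ P →
      ∀ Q : Ideal (𝓞 L), Q.IsPrime → Q.comap (algebraMap (𝓞 K) (𝓞 L)) = P →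
        Ideal.ramificationIdx' P Q = 1) :
    False := by
  have hd0 : 0 < d := by
    simp at hd; omega
  have hM := lemMink K L d hd0 s hs hK hdeg
  rw [natAbs_discr_eq_absNorm_differentIdeal_mul_natAbs_discr_pow K (𝓞 K) L (𝓞 L), hdeg] at hM
  have hC := lemC K L hK hdeg hunr
  have hintg (y : K) (b c : ℤ) (hy : y ^ 2 + b * y + c = 0) : ∃ x : 𝓞 K, x ^ 2 + b * x + c = 0 := by
    have : IsIntegral ℤ y := by
      open Polynomial in
      refine ⟨X ^ 2 + C b * X + C c, by monicity!, ?_⟩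
      simp only [eval₂_add, eval₂_mul, eval₂_pow, eval₂_X, eval₂_C]
      simp only [eq_intCast]
      exact hy
    obtain ⟨x, hxy⟩ : ∃ x : 𝓞 K, algebraMap (𝓞 K) K x = y :=
      ⟨⟨y, this⟩, rfl⟩
    refine ⟨x, ?_⟩
    apply FaithfulSMul.algebraMap_injective (𝓞 K) K
    rw [map_add, map_add, map_pow, map_mul, map_intCast, map_intCast, map_zero, hxy]
    exact hy
  set N := Ideal.absNorm (differentIdeal (𝓞 K) (𝓞 L))
  have fin1 (m : ℕ) (hm : m ≤ 8) (hdv : (discr K).natAbs ∣ m) (hm0 : 0 < m) (h2 : ¬ Prime (2 : 𝓞 K)) : False := by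
    have hN : N = 1 := hC.resolve_right fun h => h2 h.1
    have hle := (Nat.le_of_dvd hm0 hdv).trans hm
    have := Nat.pow_le_pow_left hle 3
    rw [hN] at hM
    omega
  simp only [Finset.mem_insert, Finset.mem_singleton] at hd
  rcases hd with rfl | rfl | rfl | rfl
  · obtain ⟨x, hx⟩ := hintg s 0 1 (by rw [hs]; simp)
    have hD := lemD hK x 0 1 hx (by norm_num)
    exact fin1 4 (by norm_num) hD (by norm_num) (two_not_prime_of_sq_eq_neg_one x (by simpa using eq_neg_of_add_eq_zero_left hx))
  · obtain ⟨x, hx⟩ := hintg s 0 2 (by rw [hs]; simp)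
    have hD := lemD hK x 0 2 hx (by norm_num)
    refine fin1 8 (by norm_num) hD (by norm_num) ?_
    intro h
    have hx' : x ^ 2 + 2 = 0 := by simpa using hx
    obtain ⟨t, rfl⟩ := h.dvd_of_dvd_pow (a := x) (n := 2) ⟨-1, by linear_combination hx'⟩
    have h1 : 2 * t ^ 2 + 1 = 0 := mul_left_cancel₀ (two_ne_zero (α := 𝓞 K)) (by linear_combination hx')
    exact h.not_isUnit (IsUnit.of_mul_eq_one (-t ^ 2) (by linear_combination -h1))
  · obtain ⟨x, hx⟩ := hintg ((1 + s) / 2) (-1) 1 (by push_cast at *; linear_combination hs / 4)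
    have hD := lemD hK x (-1) 1 hx (by norm_num)
    have hle : (discr K).natAbs ≤ 3 := Nat.le_of_dvd (by norm_num) hD
    have hN : N ≤ 16 := by rcases hC with h | h <;> omega
    have := Nat.mul_le_mul hN (Nat.pow_le_pow_left hle 3)
    omega
  · obtain ⟨x, hx⟩ := hintg ((1 + s) / 2) (-1) 2 (by push_cast at *; linear_combination hs / 4)
    have hD := lemD hK x (-1) 2 hx (by norm_num)
    refine fin1 7 (by norm_num) hD (by norm_num) (not_prime_seven x ?_)
    push_cast at hx
    linear_combination hx
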